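/- arXiv:2512.06425 — 2 statements merged into one kernel-verified Lean document; each statement's English description precedes it below -/
import Mathlib

section
/- Let (X,𝔐,μ,f,w) be a dissipative invertible weighted p-measurable system with wandering set W satisfying 0 < μ(W) < ∞, and let ν(B) = Σ_{n∈ℤ} μ_n(B ∩ f^{−n}(W)). Then C_{w,f} is Devaney chaotic on L^p(μ) if and only if for each ε > 0 and each B ∈ 𝔐 with ν(B) < ∞ there exists a measurable set B' ⊆ B such that ν(B∖B') < ε and Σ_{n∈ℤ} ν(f^n(B')) < ∞. -/
open Filter Topology MeasureTheory
open scoped ENNReal NNReal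

/-- The bilateral sequence of weight functions `w^(n)` associated to a bijection `f` and a
weight `w`:  `w^(0) = 1`, `w^(n) = (w∘f^(n-1))⋯(w∘f)·w` for `n ≥ 1`, and
`w^(-n) = (w̃∘f^(-(n-1)))⋯(w̃∘f⁻¹)·w̃` where `w̃ = 1/(w∘f⁻¹)`. -/
noncomputable def wpow {𝕜 X : Type*} [RCLike 𝕜] (f : Equiv.Perm X) (w : X → 𝕜) (n : ℤ)
    (x : X) : 𝕜 :=
  if 0 ≤ n then ∏ j ∈ Finset.range n.toNat, w ((f ^ (j : ℤ)) x)
  else (∏ j ∈ Finset.range (-n).toNat, w ((f ^ (n + (j : ℤ))) x))⁻¹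

/-- The measure `ν(B) = Σ_{n ∈ ℤ} μ_n(B ∩ f⁻ⁿ(W))`, where `μ_n(B) = ∫_B |w^(n)|^p dμ`. -/
noncomputable def nuMeas {𝕜 X : Type*} [RCLike 𝕜] [MeasurableSpace X] (μ : Measure X)
    (p : ℝ≥0∞) (f : Equiv.Perm X) (w : X → 𝕜) (W : Set X) : Measure X :=
  Measure.sum fun n : ℤ =>
    (μ.withDensity fun x => (‖wpow f w n x‖₊ : ℝ≥0∞) ^ p.toReal).restrict (⇑(f ^ n) ⁻¹' W)

/-- A map `T` is topologically transitive if for all nonempty open sets `U`, `V` there is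
`n ∈ ℕ₀` with `T^n(U) ∩ V ≠ ∅`. -/
def TopologicallyTransitive {E : Type*} [TopologicalSpace E] (T : E → E) : Prop :=
  ∀ U V : Set E, IsOpen U → IsOpen V → U.Nonempty → V.Nonempty →
    ∃ n : ℕ, (T^[n] '' U ∩ V).Nonempty

/-- A map `T` is Devaney chaotic if it is topologically transitive and has a dense set of
periodic points. -/
def DevaneyChaotic {E : Type*} [TopologicalSpace E] (T : E → E) : Prop :=
  TopologicallyTransitive T ∧ Dense {y : E | ∃ n : ℕ, 0 < n ∧ T^[n] y = y}

/-- `J` records the level of a point in a dissipative system: `f` lowers it by one. -/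
theorem level_zpow {X : Type*} {f : Equiv.Perm X} {J : X → ℤ} (hJ : ∀ x, J (f x) = J x - 1)
    (n : ℤ) (x : X) : J ((f ^ n) x) = J x - n := by
  induction n using Int.induction_on generalizing x with
  | zero => simp
  | succ n ih =>
    rw [zpow_add_one, Equiv.Perm.mul_apply, ih, hJ]
    ring
  | pred n ih =>
    have h := hJ (f⁻¹ x)
    rw [show f (f⁻¹ x) = x from f.apply_symm_apply x] at h
    rw [zpow_sub_one, Equiv.Perm.mul_apply, ih]
    linarith

theorem zpow_image_eq_preimage {X : Type*} {f : Equiv.Perm X} (n : ℤ) (A : Set X) :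
    ⇑(f ^ n) '' A = ⇑(f ^ (-n)) ⁻¹' A := by
  rw [zpow_neg]
  exact Equiv.image_eq_preimage_symm _ _

section Dynamics

variable {𝕜 X : Type*} [RCLike 𝕜] [MeasurableSpace X] {ν : Measure X} {p : ℝ≥0∞}
  {f : Equiv.Perm X} {J : X → ℤ}

theorem quasiMeasurePreserving_zpow (hf : Measure.QuasiMeasurePreserving f ν ν)
    (hf' : Measure.QuasiMeasurePreserving f.symm ν ν) (n : ℤ) :
    Measure.QuasiMeasurePreserving (⇑(f ^ n)) ν ν := by
  obtain ⟨k, rfl | rfl⟩ := n.eq_nat_or_neg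
  · rw [zpow_natCast, ← Equiv.Perm.iterate_eq_pow]
    exact hf.iterate k
  · rw [zpow_neg, zpow_natCast, ← inv_pow, ← Equiv.Perm.iterate_eq_pow]
    exact hf'.iterate k

variable [Fact (1 ≤ p)]

theorem iterate_eq_zpow_apply (S : Lp 𝕜 p ν ≃L[𝕜] Lp 𝕜 p ν) (k : ℕ) (φ : Lp 𝕜 p ν) :
    S^[k] φ = (S ^ (k : ℤ)) φ := by
  rw [zpow_natCast]
  induction k generalizing φ with
  | zero => rfl
  | succ k ih => rw [pow_succ, Function.iterate_succ_apply, ih]; rfl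

theorem zpow_coeFn_ae_eq (hf : Measure.QuasiMeasurePreserving f ν ν)
    (hf' : Measure.QuasiMeasurePreserving f.symm ν ν) (S : Lp 𝕜 p ν ≃L[𝕜] Lp 𝕜 p ν)
    (hS : ∀ φ : Lp 𝕜 p ν, ⇑(S φ) =ᵐ[ν] fun x => φ (f x)) (n : ℤ) (φ : Lp 𝕜 p ν) :
    ⇑((S ^ n) φ) =ᵐ[ν] fun x => φ ((f ^ n) x) := by
  induction n using Int.induction_on generalizing φ with
  | zero => exact Filter.EventuallyEq.rfl
  | succ n ih =>
    filter_upwards [ih (S φ), (quasiMeasurePreserving_zpow hf hf' n).ae (hS φ)] with x h1 h2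
    rw [zpow_add_one, add_comm, zpow_one_add, Equiv.Perm.mul_apply, ← h2, ← h1]
    rfl
  | pred n ih =>
    have hinv : ⇑(S⁻¹ φ) =ᵐ[ν] fun x => φ (f⁻¹ x) := by
      filter_upwards [hf'.ae (hS (S⁻¹ φ))] with x hx
      rw [show S (S⁻¹ φ) = φ from S.apply_symm_apply φ] at hx
      rw [show f⁻¹ x = f.symm x from rfl, hx, f.apply_symm_apply]
    filter_upwards [ih (S⁻¹ φ), (quasiMeasurePreserving_zpow hf hf' (-n)).ae hinv] with x h1 h2
    rw [zpow_sub_one, sub_eq_neg_add, zpow_add, zpow_neg_one, Equiv.Perm.mul_apply, ← h2, ← h1]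
    rfl

/-- Most of a set of finite measure lives on finitely many levels. -/
theorem exists_measure_level_lt (hJm : Measurable J) {B : Set X} (hB : MeasurableSet B)
    (hBν : ν B < ⊤) {ε : ℝ≥0∞} (hε : 0 < ε) :
    ∃ M : ℕ, ν {x ∈ B | (M : ℤ) < |J x|} < ε := by
  have hm (M : ℕ) : MeasurableSet {x ∈ B | (M : ℤ) < |J x|} :=
    hB.inter (hJm (MeasurableSet.of_discrete (s := {j : ℤ | (M : ℤ) < |j|})))
  have hempty : ⋂ M : ℕ, {x ∈ B | (M : ℤ) < |J x|} = ∅ := by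
    refine Set.eq_empty_iff_forall_notMem.2 fun x hx => ?_
    have h := (Set.mem_iInter.1 hx (J x).natAbs).2
    rw [Int.natCast_natAbs] at h
    exact lt_irrefl _ h
  obtain ⟨M, hM⟩ := exists_measure_iInter_lt (fun M => (hm M).nullMeasurableSet) hε
    ⟨0, ne_top_of_le_ne_top hBν.ne (measure_mono (Set.sep_subset _ _))⟩ hempty
  refine ⟨M, (measure_mono fun x hx => ?_).trans_lt hM⟩
  exact Set.mem_iInter₂.2 fun N hNM => ⟨hx.1, lt_of_le_of_lt (by exact_mod_cast hNM) hx.2⟩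

/-- Translates of a set meeting finitely many levels overlap boundedly often. -/
theorem tsum_measure_zpow_image_lt_top (hf : Measure.QuasiMeasurePreserving f ν ν)
    (hf' : Measure.QuasiMeasurePreserving f.symm ν ν)
    (hJm : Measurable J) (hJ : ∀ x, J (f x) = J x - 1) {A E : Set X} (hA : MeasurableSet A)
    (M : ℕ) (hAM : ∀ x ∈ A, |J x| ≤ M) (hE : ν E < ⊤) (hAE : ∀ n : ℤ, ⇑(f ^ n) '' A ≤ᵐ[ν] E) :
    ∑' n : ℤ, ν (⇑(f ^ n) '' A) < ⊤ := by
  set s : Finset ℤ := Finset.Icc (-M : ℤ) M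
  have hlevel (j : ℤ) : MeasurableSet (A ∩ J ⁻¹' {j}) :=
    hA.inter (hJm (measurableSet_singleton j))
  have hle (n : ℤ) : ν (⇑(f ^ n) '' A) ≤ ∑ j ∈ s, ν (⇑(f ^ n) '' (A ∩ J ⁻¹' {j})) := by
    refine (measure_mono ?_).trans (measure_biUnion_finset_le s _)
    rintro _ ⟨x, hx, rfl⟩
    exact Set.mem_biUnion (x := J x) (by simpa [s, abs_le] using hAM x hx) ⟨x, ⟨hx, rfl⟩, rfl⟩
  have hone (j : ℤ) : ∑' n : ℤ, ν (⇑(f ^ n) '' (A ∩ J ⁻¹' {j})) ≤ ν E := by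
    rw [← measure_iUnion]
    · refine measure_mono_ae ?_
      have h : ∀ᵐ x ∂ν, ∀ n : ℤ, x ∈ ⇑(f ^ n) '' A → x ∈ E := ae_all_iff.2 hAE
      filter_upwards [h] with x hx hxA
      obtain ⟨n, hn⟩ := Set.mem_iUnion.1 hxA
      exact hx n (Set.image_mono Set.inter_subset_left hn)
    · refine fun m n hmn => Set.disjoint_left.2 ?_
      rintro _ ⟨x, ⟨-, hx⟩, rfl⟩ ⟨y, ⟨-, hy⟩, hxy⟩
      have h := congrArg J hxy
      rw [level_zpow hJ, level_zpow hJ, hx, hy] at h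
      exact hmn (by linarith)
    · intro n
      rw [zpow_image_eq_preimage]
      exact (quasiMeasurePreserving_zpow hf hf' _).measurable (hlevel j)
  calc ∑' n : ℤ, ν (⇑(f ^ n) '' A)
      ≤ ∑' n : ℤ, ∑ j ∈ s, ν (⇑(f ^ n) '' (A ∩ J ⁻¹' {j})) := ENNReal.tsum_le_tsum hle
    _ = ∑ j ∈ s, ∑' n : ℤ, ν (⇑(f ^ n) '' (A ∩ J ⁻¹' {j})) :=
        Summable.tsum_finsetSum fun _ _ => ENNReal.summable
    _ ≤ ∑ j ∈ s, ν E := Finset.sum_le_sum fun j _ => hone j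
    _ < ⊤ := by
        rw [Finset.sum_const, nsmul_eq_mul]
        exact ENNReal.mul_lt_top (ENNReal.natCast_lt_top _) hE

theorem exists_subset_of_dense_periodic (hp : p ≠ ⊤)
    (hf : Measure.QuasiMeasurePreserving f ν ν)
    (hf' : Measure.QuasiMeasurePreserving f.symm ν ν)
    (hJm : Measurable J) (hJ : ∀ x, J (f x) = J x - 1) (S : Lp 𝕜 p ν ≃L[𝕜] Lp 𝕜 p ν)
    (hS : ∀ φ : Lp 𝕜 p ν, ⇑(S φ) =ᵐ[ν] fun x => φ (f x))
    (hper : Dense {φ : Lp 𝕜 p ν | ∃ n : ℕ, 0 < n ∧ S^[n] φ = φ})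
    {ε : ℝ≥0∞} (hε : 0 < ε) {B : Set X} (hB : MeasurableSet B) (hBν : ν B < ⊤) :
    ∃ B' : Set X, MeasurableSet B' ∧ B' ⊆ B ∧ ν (B \ B') < ε ∧
      ∑' n : ℤ, ν (⇑(f ^ n) '' B') < ⊤ := by
  have hp1 : (1 : ℝ≥0∞) ≤ p := Fact.out
  have hp0 : p ≠ 0 := (zero_lt_one.trans_le hp1).ne'
  obtain ⟨M, hM⟩ := exists_measure_level_lt hJm hB hBν (ENNReal.half_pos hε.ne')
  set χ : Lp 𝕜 p ν := indicatorConstLp p hB hBν.ne (1 : 𝕜)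
  have hconv : Tendsto (fun φ : Lp 𝕜 p ν => ν {x | 2⁻¹ ≤ edist (φ x) (χ x)}) (𝓝 χ) (𝓝 0) :=
    tendstoInMeasure_of_tendsto_Lp (f := fun φ : Lp 𝕜 p ν => φ) tendsto_id 2⁻¹ (by simp)
  obtain ⟨U, hU, hUo, hχU⟩ := eventually_nhds_iff.1
    (hconv.eventually (gt_mem_nhds (ENNReal.half_pos hε.ne')))
  obtain ⟨ψ, hψU, N, hN, hψ⟩ := hper.inter_open_nonempty U hUo ⟨χ, hχU⟩
  have hψ' : (S ^ (N : ℤ)) ψ = ψ := (iterate_eq_zpow_apply S N ψ).symm.trans hψ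
  set F : ℤ → Set X := fun n => {x | 4⁻¹ ≤ ‖((S ^ n) ψ) x‖ₑ}
  have hFmod (n : ℤ) : F n = F (n % N) := by
    have hfix (k : ℤ) : (S ^ ((N : ℤ) * k)) ψ = ψ := by
      rw [zpow_mul]
      induction k using Int.induction_on with
      | zero => rfl
      | succ k ih =>
        rw [zpow_add_one]
        exact (congrArg _ hψ').trans ih
      | pred k ih =>
        rw [zpow_sub_one]
        exact (congrArg _ ((ContinuousLinearEquiv.symm_apply_eq _).2 hψ'.symm)).trans ih
    have : (S ^ n) ψ = (S ^ (n % N)) ψ := by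
      conv_lhs => rw [← Int.emod_add_mul_ediv n N, zpow_add]
      exact congrArg (S ^ (n % N)) (hfix _)
    simp only [F, this]
  set E : Set X := ⋃ r ∈ Finset.range N, F (r : ℤ)
  have hFE (n : ℤ) : F n ⊆ E := by
    have hN' : (0 : ℤ) < N := by exact_mod_cast hN
    obtain ⟨r, hr⟩ := Int.eq_ofNat_of_zero_le (Int.emod_nonneg n hN'.ne')
    have hlt := Int.emod_lt_of_pos n hN'
    rw [hFmod, hr]
    exact Set.subset_biUnion_of_mem (u := fun r : ℕ => F (r : ℤ))
      (Finset.mem_coe.2 (Finset.mem_range.2 (by omega)))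
  have hEν : ν E < ⊤ := by
    refine (measure_biUnion_finset_le _ _).trans_lt (ENNReal.sum_lt_top.2 fun r _ => ?_)
    exact (Lp.memLp ((S ^ (r : ℤ)) ψ)).meas_ge_lt_top'_enorm hp0 hp (ε := 4⁻¹) (by simp)
      (by simp)
  have hψm : Measurable fun x => ‖ψ x‖ₑ := (Lp.stronglyMeasurable ψ).measurable.enorm
  have hB'm : MeasurableSet {x ∈ B | 4⁻¹ ≤ ‖ψ x‖ₑ ∧ |J x| ≤ M} :=
    hB.inter ((measurableSet_le measurable_const hψm).inter
      (hJm (MeasurableSet.of_discrete (s := {j : ℤ | |j| ≤ M}))))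
  refine ⟨{x ∈ B | 4⁻¹ ≤ ‖ψ x‖ₑ ∧ |J x| ≤ M}, hB'm, Set.sep_subset _ _, ?_,
    tsum_measure_zpow_image_lt_top hf hf' hJm hJ hB'm M (fun x hx => hx.2.2) hEν fun n => ?_⟩
  · have hsub : ν (B \ {x ∈ B | 4⁻¹ ≤ ‖ψ x‖ₑ ∧ |J x| ≤ M}) ≤
        ν ({x | 2⁻¹ ≤ edist (ψ x) (χ x)} ∪ {x ∈ B | (M : ℤ) < |J x|}) := by
      refine measure_mono_ae ?_
      filter_upwards [indicatorConstLp_coeFn (p := p) (hs := hB) (hμs := hBν.ne) (c := (1 : 𝕜))]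
        with x hx hxB
      have hxB : x ∈ B \ {x ∈ B | 4⁻¹ ≤ ‖ψ x‖ₑ ∧ |J x| ≤ M} := hxB
      show x ∈ {x | 2⁻¹ ≤ edist (ψ x) (χ x)} ∪ {x ∈ B | (M : ℤ) < |J x|}
      by_cases hJx : |J x| ≤ M
      · left
        have h4 : ‖ψ x‖ₑ < 4⁻¹ := by
          by_contra h
          exact hxB.2 ⟨hxB.1, not_lt.1 h, hJx⟩
        have hχx : χ x = 1 := by rw [hx, Set.indicator_of_mem hxB.1]
        show 2⁻¹ ≤ edist (ψ x) (χ x)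
        by_contra h
        have h1 : edist (1 : 𝕜) 0 ≤ edist (ψ x) 1 + edist (ψ x) 0 := edist_triangle_left _ _ _
        rw [hχx, not_le] at h
        rw [edist_zero_right, edist_zero_right, enorm_one] at h1
        have h2 := h1.trans_lt (ENNReal.add_lt_add h h4)
        have h3 : (2⁻¹ : ℝ≥0∞) + 4⁻¹ ≤ 2⁻¹ + 2⁻¹ := by
          gcongr; norm_num
        rw [ENNReal.inv_two_add_inv_two] at h3
        exact absurd h2 (not_lt.2 h3)
      · exact Or.inr ⟨hxB.1, not_le.1 hJx⟩
    refine (hsub.trans (measure_union_le _ _)).trans_lt ?_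
    rw [← ENNReal.add_halves ε]
    exact ENNReal.add_lt_add (hU ψ hψU) hM
  · filter_upwards [zpow_coeFn_ae_eq hf hf' S hS (-n) ψ] with x hx hxA
    rw [zpow_image_eq_preimage] at hxA
    refine hFE (-n) ?_
    show 4⁻¹ ≤ ‖((S ^ (-n)) ψ) x‖ₑ
    rw [hx]
    exact hxA.2.1

/-- Measurable functions supported on finitely many levels whose translates have summable `p`-th
powers of `L^p` norms. -/
def OrbitSummable (ν : Measure X) (p : ℝ≥0∞) (f : Equiv.Perm X) (J : X → ℤ) (g : X → 𝕜) : Prop :=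
  Measurable g ∧ (∃ M : ℕ, ∀ x, g x ≠ 0 → |J x| ≤ M) ∧
    ∑' n : ℤ, ∫⁻ x, ‖g ((f ^ n) x)‖ₑ ^ p.toReal ∂ν < ⊤

omit [Fact (1 ≤ p)] in
theorem OrbitSummable.memLp (hp0 : p ≠ 0) (hp : p ≠ ⊤) {g : X → 𝕜}
    (hg : OrbitSummable ν p f J g) : MemLp g p ν := by
  refine ⟨hg.1.aestronglyMeasurable, ?_⟩
  rw [eLpNorm_lt_top_iff_lintegral_rpow_enorm_lt_top hp0 hp]
  exact (ENNReal.le_tsum (f := fun n : ℤ => ∫⁻ x, ‖g ((f ^ n) x)‖ₑ ^ p.toReal ∂ν) 0).trans_lt hg.2.2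

theorem OrbitSummable.add (hp : p ≠ ⊤) (hf : Measure.QuasiMeasurePreserving f ν ν)
    (hf' : Measure.QuasiMeasurePreserving f.symm ν ν) {g₁ g₂ : X → 𝕜}
    (h₁ : OrbitSummable ν p f J g₁) (h₂ : OrbitSummable ν p f J g₂) :
    OrbitSummable ν p f J (g₁ + g₂) := by
  obtain ⟨hm₁, ⟨M₁, hM₁⟩, hs₁⟩ := h₁
  obtain ⟨hm₂, ⟨M₂, hM₂⟩, hs₂⟩ := h₂
  have hq : 1 ≤ p.toReal := by
    simpa using ENNReal.toReal_mono hp (Fact.out : (1 : ℝ≥0∞) ≤ p)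
  set C : ℝ≥0∞ := 2 ^ (p.toReal - 1)
  have hC : C < ⊤ := ENNReal.rpow_lt_top_of_nonneg (by linarith) (by simp)
  refine ⟨hm₁.add hm₂, ⟨max M₁ M₂, fun x hx => ?_⟩, ?_⟩
  · by_cases hx₁ : g₁ x = 0
    · have hx₂ : g₂ x ≠ 0 := fun h => hx (by simp [hx₁, h])
      exact (hM₂ x hx₂).trans (by exact_mod_cast le_max_right _ _)
    · exact (hM₁ x hx₁).trans (by exact_mod_cast le_max_left _ _)
  · have hle (n : ℤ) : ∫⁻ x, ‖(g₁ + g₂) ((f ^ n) x)‖ₑ ^ p.toReal ∂ν ≤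
        C * (∫⁻ x, ‖g₁ ((f ^ n) x)‖ₑ ^ p.toReal ∂ν + ∫⁻ x, ‖g₂ ((f ^ n) x)‖ₑ ^ p.toReal ∂ν) := by
      have hfn := (quasiMeasurePreserving_zpow hf hf' n).measurable
      have hm : Measurable fun x => ‖g₁ ((f ^ n) x)‖ₑ ^ p.toReal :=
        (hm₁.comp hfn).enorm.pow_const _
      rw [← lintegral_add_left hm, ← lintegral_const_mul']
      · refine lintegral_mono fun x => ?_
        refine le_trans ?_ (ENNReal.rpow_add_le_mul_rpow_add_rpow _ _ hq)
        exact ENNReal.rpow_le_rpow (enorm_add_le _ _) (by linarith)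
      · exact hC.ne
    refine (ENNReal.tsum_le_tsum hle).trans_lt ?_
    rw [ENNReal.tsum_mul_left, ENNReal.tsum_add]
    exact ENNReal.mul_lt_top hC (ENNReal.add_lt_top.2 ⟨hs₁, hs₂⟩)

theorem exists_orbitSummable_eLpNorm_sub_le (hp : p ≠ ⊤)
    (hf : Measure.QuasiMeasurePreserving f ν ν)
    (hf' : Measure.QuasiMeasurePreserving f.symm ν ν) (hJm : Measurable J)
    (H : ∀ ε : ℝ≥0∞, 0 < ε → ∀ B : Set X, MeasurableSet B → ν B < ⊤ →
      ∃ B' : Set X, MeasurableSet B' ∧ B' ⊆ B ∧ ν (B \ B') < ε ∧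
        ∑' n : ℤ, ν (⇑(f ^ n) '' B') < ⊤)
    {φ : X → 𝕜} (hφ : MemLp φ p ν) {ε : ℝ≥0∞} (hε : ε ≠ 0) :
    ∃ g : X → 𝕜, eLpNorm (φ - g) p ν ≤ ε ∧ OrbitSummable ν p f J g := by
  have hq : 0 < p.toReal :=
    ENNReal.toReal_pos (zero_lt_one.trans_le (Fact.out : (1 : ℝ≥0∞) ≤ p)).ne' hp
  refine hφ.induction_dense hp (OrbitSummable ν p f J) ?_
    (fun g₁ g₂ h₁ h₂ => h₁.add hp hf hf' h₂) (fun g hg => hg.1.aestronglyMeasurable) hε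
  intro c s hs hsν ε hε
  obtain ⟨η, hη, hηc⟩ := exists_eLpNorm_indicator_le (μ := ν) hp c hε
  have hη2 : (0 : ℝ≥0∞) < η / 2 := ENNReal.half_pos (by exact_mod_cast hη.ne')
  obtain ⟨B, hB, hBs, hsB, hsum⟩ := H _ hη2 s hs hsν
  obtain ⟨M, hM⟩ := exists_measure_level_lt hJm hs hsν hη2
  set A : Set X := {x ∈ B | |J x| ≤ M}
  have hA : MeasurableSet A := hB.inter (hJm (MeasurableSet.of_discrete (s := {j : ℤ | |j| ≤ M})))
  have hAs : A ⊆ s := fun x hx => hBs hx.1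
  refine ⟨A.indicator fun _ => c, ?_, measurable_const.indicator hA, ⟨M, fun x hx => ?_⟩, ?_⟩
  · rw [eLpNorm_sub_comm, ← Set.indicator_sdiff hAs]
    refine hηc _ ?_
    have hsub : s \ A ⊆ (s \ B) ∪ {x ∈ s | (M : ℤ) < |J x|} := by
      intro x hx
      by_cases hxB : x ∈ B
      · exact Or.inr ⟨hx.1, not_le.1 fun h => hx.2 ⟨hxB, h⟩⟩
      · exact Or.inl ⟨hx.1, hxB⟩
    refine ((measure_mono hsub).trans (measure_union_le _ _)).trans ?_
    rw [← ENNReal.add_halves (η : ℝ≥0∞)]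
    exact add_le_add hsB.le hM.le
  · exact (Set.mem_of_indicator_ne_zero hx).2
  · have hle (n : ℤ) : ∫⁻ x, ‖A.indicator (fun _ => c) ((f ^ n) x)‖ₑ ^ p.toReal ∂ν ≤
        ‖c‖ₑ ^ p.toReal * ν (⇑(f ^ (-n)) '' B) := by
      have hBn : MeasurableSet (⇑(f ^ n) ⁻¹' B) :=
        (quasiMeasurePreserving_zpow hf hf' n).measurable hB
      rw [zpow_image_eq_preimage, neg_neg, ← lintegral_indicator_const hBn]
      refine lintegral_mono fun x => ?_
      by_cases hx : (f ^ n) x ∈ A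
      · have hxB : x ∈ ⇑(f ^ n) ⁻¹' B := hx.1
        simp [hx, hxB]
      · simp [hx, hq]
    refine (ENNReal.tsum_le_tsum hle).trans_lt ?_
    have hneg := (Equiv.neg ℤ).tsum_eq fun n => ν (⇑(f ^ n) '' B)
    simp only [Equiv.neg_apply] at hneg
    rw [ENNReal.tsum_mul_left, hneg]
    exact ENNReal.mul_lt_top (ENNReal.rpow_lt_top_of_nonneg hq.le enorm_ne_top) hsum

/-- Orbits of orbit-summable functions tend to zero in both time directions. -/
theorem OrbitSummable.tendsto_zpow (hp0 : p ≠ 0) (hp : p ≠ ⊤)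
    (hf : Measure.QuasiMeasurePreserving f ν ν)
    (hf' : Measure.QuasiMeasurePreserving f.symm ν ν) (S : Lp 𝕜 p ν ≃L[𝕜] Lp 𝕜 p ν)
    (hS : ∀ φ : Lp 𝕜 p ν, ⇑(S φ) =ᵐ[ν] fun x => φ (f x)) {g : X → 𝕜}
    (hg : OrbitSummable ν p f J g) :
    Tendsto (fun n : ℤ => (S ^ n) ((hg.memLp hp0 hp).toLp g)) cofinite (𝓝 0) := by
  have hq : 0 < p.toReal := ENNReal.toReal_pos hp0 hp
  rw [tendsto_zero_iff_enorm_tendsto_zero]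
  have hnorm (n : ℤ) : ‖(S ^ n) ((hg.memLp hp0 hp).toLp g)‖ₑ =
      (∫⁻ x, ‖g ((f ^ n) x)‖ₑ ^ p.toReal ∂ν) ^ (1 / p.toReal) := by
    rw [Lp.enorm_def, eLpNorm_eq_lintegral_rpow_enorm_toReal hp0 hp]
    congr 1
    refine lintegral_congr_ae ?_
    filter_upwards [zpow_coeFn_ae_eq hf hf' S hS n ((hg.memLp hp0 hp).toLp g),
      (quasiMeasurePreserving_zpow hf hf' n).ae (hg.memLp hp0 hp).coeFn_toLp] with x h1 h2
    rw [h1, h2]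
  simp_rw [hnorm]
  have h := (ENNReal.tendsto_cofinite_zero_of_tsum_ne_top hg.2.2.ne).ennrpow_const (1 / p.toReal)
  rwa [ENNReal.zero_rpow_of_pos (by positivity)] at h

omit [Fact (1 ≤ p)] in
/-- Periodizing an orbit-summable function along a long period changes it little. -/
theorem OrbitSummable.exists_periodic (hp0 : p ≠ 0) (hp : p ≠ ⊤)
    (hf : Measure.QuasiMeasurePreserving f ν ν)
    (hf' : Measure.QuasiMeasurePreserving f.symm ν ν)
    (hJm : Measurable J) (hJ : ∀ x, J (f x) = J x - 1) {g : X → 𝕜}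
    (hg : OrbitSummable ν p f J g) {ε : ℝ≥0∞} (hε : 0 < ε) :
    ∃ (N : ℕ) (G : X → 𝕜), 0 < N ∧ MemLp G p ν ∧ (∀ x, G ((f ^ (N : ℤ)) x) = G x) ∧
      eLpNorm (G - g) p ν < ε := by
  have hq : 0 < p.toReal := ENNReal.toReal_pos hp0 hp
  have hgp := hg.memLp hp0 hp
  obtain ⟨hgm, ⟨M₀, hM₀⟩, hsum⟩ := hg
  have hfm (n : ℤ) := (quasiMeasurePreserving_zpow hf hf' n).measurable
  obtain ⟨t, ht⟩ := ((ENNReal.tendsto_tsum_compl_atTop_zero hsum.ne).eventually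
    (gt_mem_nhds (ENNReal.rpow_pos_of_nonneg hε hq.le))).exists
  obtain ⟨M, hMM₀, hMt⟩ : ∃ M : ℕ, M₀ ≤ M ∧ ∀ n ∈ t, |n| ≤ M := by
    refine ⟨max M₀ (t.sup Int.natAbs), le_max_left _ _, fun n hn => ?_⟩
    rw [← Int.natCast_natAbs]
    exact_mod_cast (Finset.le_sup (f := Int.natAbs) hn).trans (le_max_right _ _)
  set N : ℕ := 2 * M + 1
  have hN : (0 : ℤ) < N := by positivity
  set k : X → ℤ := fun x => (J x + M) / N
  have hkm : Measurable k := (Measurable.of_discrete (f := fun j : ℤ => (j + M) / N)).comp hJm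
  set G : X → 𝕜 := fun x => g ((f ^ (k x * N)) x)
  have hGm : Measurable G := by
    have h : Measurable fun z : X × ℤ => g ((f ^ (z.2 * N)) z.1) :=
      measurable_from_prod_countable_left fun j => hgm.comp (hfm (j * N))
    exact h.comp (measurable_id.prodMk hkm)
  have hper (x : X) : G ((f ^ (N : ℤ)) x) = G x := by
    have hk : k ((f ^ (N : ℤ)) x) = k x - 1 := by
      simp only [k, level_zpow hJ]
      rw [show J x - N + M = J x + M + (-1) * N by ring, Int.add_mul_ediv_right _ _ hN.ne']
      ring
    simp only [G, hk, ← Equiv.Perm.mul_apply, ← zpow_add]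
    congr 3
    ring
  have hbound (x : X) : ‖(G - g) x‖ₑ ^ p.toReal ≤
      ∑' n : {n : ℤ // n ∉ t}, ‖g ((f ^ (n : ℤ)) x)‖ₑ ^ p.toReal := by
    by_cases hk : k x = 0
    · simp [G, hk, hq]
    · have hgx : g x = 0 := by
        by_contra h
        have h1 := abs_le.1 ((hM₀ x h).trans (by exact_mod_cast hMM₀ : (M₀ : ℤ) ≤ M))
        exact hk (Int.ediv_eq_zero_of_lt (by linarith) (by simp only [N]; push_cast; linarith))
      have hkt : k x * N ∉ t := by
        intro h
        have h1 := hMt _ h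
        have h2 : 1 ≤ |k x| := Int.one_le_abs hk
        rw [abs_mul, abs_of_pos hN] at h1
        have h3 : (N : ℤ) ≤ M := (le_mul_of_one_le_left hN.le h2).trans h1
        simp only [N] at h3
        push_cast at h3
        linarith [Int.natCast_nonneg M]
      simp only [Pi.sub_apply, hgx, sub_zero]
      exact ENNReal.le_tsum (f := fun n : {n : ℤ // n ∉ t} => ‖g ((f ^ (n : ℤ)) x)‖ₑ ^ p.toReal)
        ⟨k x * N, hkt⟩
  have hlt : eLpNorm (G - g) p ν < ε := by
    rw [eLpNorm_eq_lintegral_rpow_enorm_toReal hp0 hp, one_div, ENNReal.rpow_inv_lt_iff hq]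
    refine (lintegral_mono hbound).trans_lt ?_
    have hm (n : {n : ℤ // n ∉ t}) : AEMeasurable (fun x => ‖g ((f ^ (n : ℤ)) x)‖ₑ ^ p.toReal) ν :=
      ((hgm.comp (hfm n)).enorm.pow_const _).aemeasurable
    rwa [lintegral_tsum hm]
  refine ⟨N, G, by positivity, ?_, hper, hlt⟩
  have hsub : MemLp (G - g) p ν := ⟨(hGm.sub hgm).aestronglyMeasurable, hlt.trans_le le_top⟩
  simpa using hsub.add hgp

/-- Devaney chaos for the composition operator of a dissipative system. -/
theorem devaneyChaotic_composition_iff (hp : p ≠ ⊤)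
    (hf : Measure.QuasiMeasurePreserving f ν ν)
    (hf' : Measure.QuasiMeasurePreserving f.symm ν ν)
    (hJm : Measurable J) (hJ : ∀ x, J (f x) = J x - 1) (S : Lp 𝕜 p ν ≃L[𝕜] Lp 𝕜 p ν)
    (hS : ∀ φ : Lp 𝕜 p ν, ⇑(S φ) =ᵐ[ν] fun x => φ (f x)) :
    DevaneyChaotic (⇑S) ↔
      ∀ ε : ℝ≥0∞, 0 < ε → ∀ B : Set X, MeasurableSet B → ν B < ⊤ →
        ∃ B' : Set X, MeasurableSet B' ∧ B' ⊆ B ∧ ν (B \ B') < ε ∧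
          ∑' n : ℤ, ν (⇑(f ^ n) '' B') < ⊤ := by
  have hp0 : p ≠ 0 := (zero_lt_one.trans_le (Fact.out : (1 : ℝ≥0∞) ≤ p)).ne'
  refine ⟨fun h ε hε B hB hBν =>
    exists_subset_of_dense_periodic hp hf hf' hJm hJ S hS h.2 hε hB hBν, fun H => ?_⟩
  have happrox (U : Set (Lp 𝕜 p ν)) (hU : IsOpen U) (hne : U.Nonempty) :
      ∃ (g : X → 𝕜) (hg : OrbitSummable ν p f J g), (hg.memLp hp0 hp).toLp g ∈ U := by
    obtain ⟨φ, hφ⟩ := hne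
    obtain ⟨ε, hε, hεU⟩ := EMetric.isOpen_iff.1 hU φ hφ
    obtain ⟨δ, hδ, hδε⟩ := exists_between hε
    obtain ⟨g, hgφ, hg⟩ :=
      exists_orbitSummable_eLpNorm_sub_le hp hf hf' hJm H (Lp.memLp φ) hδ.ne'
    refine ⟨g, hg, hεU ?_⟩
    rw [Metric.mem_eball, edist_comm, Lp.edist_def]
    refine lt_of_le_of_lt (le_of_eq (eLpNorm_congr_ae ?_)) (hgφ.trans_lt hδε)
    filter_upwards [(hg.memLp hp0 hp).coeFn_toLp] with x hx
    simp only [Pi.sub_apply, hx]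
  constructor
  · intro U V hU hV hUne hVne
    obtain ⟨g₁, hg₁, h₁⟩ := happrox U hU hUne
    obtain ⟨g₂, hg₂, h₂⟩ := happrox V hV hVne
    set φ₁ := (hg₁.memLp hp0 hp).toLp g₁
    set φ₂ := (hg₂.memLp hp0 hp).toLp g₂
    have hnat : Tendsto (fun n : ℕ => (n : ℤ)) atTop cofinite := by
      rw [← Nat.cofinite_eq_atTop]
      exact Nat.cast_injective.tendsto_cofinite
    have hneg : Tendsto (fun n : ℕ => -(n : ℤ)) atTop cofinite :=
      neg_injective.tendsto_cofinite.comp hnat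
    have hforward : Tendsto (fun n : ℕ => (S ^ (n : ℤ)) φ₁ + φ₂) atTop (𝓝 φ₂) := by
      simpa using ((hg₁.tendsto_zpow hp0 hp hf hf' S hS).comp hnat).add_const φ₂
    have hbackward : Tendsto (fun n : ℕ => φ₁ + (S ^ (-(n : ℤ))) φ₂) atTop (𝓝 φ₁) := by
      simpa using ((hg₂.tendsto_zpow hp0 hp hf hf' S hS).comp hneg).const_add φ₁
    obtain ⟨n, hnV, hnU⟩ := ((hforward.eventually (hV.mem_nhds h₂)).and
      (hbackward.eventually (hU.mem_nhds h₁))).exists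
    refine ⟨n, _, ⟨_, hnU, rfl⟩, ?_⟩
    rw [iterate_eq_zpow_apply, map_add]
    have hcancel : (S ^ (n : ℤ)) ((S ^ (-(n : ℤ))) φ₂) = φ₂ := by
      rw [zpow_neg]
      exact (S ^ (n : ℤ)).apply_symm_apply φ₂
    rwa [hcancel]
  · refine dense_iff_inter_open.2 fun U hU hUne => ?_
    obtain ⟨g, hg, hgU⟩ := happrox U hU hUne
    obtain ⟨ε, hε, hεU⟩ := EMetric.isOpen_iff.1 hU _ hgU
    obtain ⟨N, G, hN, hG, hper, hlt⟩ := hg.exists_periodic hp0 hp hf hf' hJm hJ hε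
    refine ⟨hG.toLp G, hεU ?_, N, hN, ?_⟩
    · rwa [Metric.mem_eball, Lp.edist_toLp_toLp]
    · rw [iterate_eq_zpow_apply]
      refine Lp.ext ?_
      filter_upwards [zpow_coeFn_ae_eq hf hf' S hS N (hG.toLp G), hG.coeFn_toLp,
        (quasiMeasurePreserving_zpow hf hf' N).ae hG.coeFn_toLp] with x h1 h2 h3
      rw [h1, h2, h3, hper]

end Dynamics

theorem TopologicallyTransitive.of_homeomorph {E F : Type*} [TopologicalSpace E]
    [TopologicalSpace F] {S : E → E} {T : F → F} (e : E ≃ₜ F) (h : Function.Semiconj e S T)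
    (hS : TopologicallyTransitive S) : TopologicallyTransitive T := by
  intro U V hU hV hUne hVne
  obtain ⟨n, _, ⟨x, hx, rfl⟩, hxV⟩ := hS (e ⁻¹' U) (e ⁻¹' V) (hU.preimage e.continuous)
    (hV.preimage e.continuous) (hUne.preimage e.surjective) (hVne.preimage e.surjective)
  exact ⟨n, _, ⟨e x, hx, rfl⟩, by rwa [← (h.iterate_right n).eq]⟩

theorem DevaneyChaotic.of_homeomorph {E F : Type*} [TopologicalSpace E]
    [TopologicalSpace F] {S : E → E} {T : F → F} (e : E ≃ₜ F) (h : Function.Semiconj e S T)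
    (hS : DevaneyChaotic S) : DevaneyChaotic T := by
  refine ⟨hS.1.of_homeomorph e h, (e.surjective.denseRange.dense_image e.continuous hS.2).mono ?_⟩
  rintro _ ⟨x, ⟨n, hn, hx⟩, rfl⟩
  exact ⟨n, hn, by rw [← (h.iterate_right n).eq, hx]⟩

theorem devaneyChaotic_iff_of_homeomorph {E F : Type*} [TopologicalSpace E]
    [TopologicalSpace F] {S : E → E} {T : F → F} (e : E ≃ₜ F) (h : Function.Semiconj e S T) :
    DevaneyChaotic S ↔ DevaneyChaotic T :=
  ⟨.of_homeomorph e h, .of_homeomorph e.symm (h.inverse_left e.left_inv e.right_inv)⟩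

theorem wpow_ne_zero {𝕜 X : Type*} [RCLike 𝕜] {f : Equiv.Perm X} {w : X → 𝕜}
    (hw : ∀ x, w x ≠ 0) (n : ℤ) (x : X) : wpow f w n x ≠ 0 := by
  unfold wpow
  split_ifs
  · exact Finset.prod_ne_zero_iff.2 fun _ _ => hw _
  · exact inv_ne_zero (Finset.prod_ne_zero_iff.2 fun _ _ => hw _)

theorem wpow_eq_mul_wpow_sub_one {𝕜 X : Type*} [RCLike 𝕜] {f : Equiv.Perm X} {w : X → 𝕜}
    (hw : ∀ x, w x ≠ 0) (n : ℤ) (x : X) : wpow f w n x = w x * wpow f w (n - 1) (f x) := by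
  have hshift (m : ℤ) : (f ^ m) (f x) = (f ^ (m + 1)) x := by
    rw [zpow_add_one, Equiv.Perm.mul_apply]
  unfold wpow
  rcases lt_or_ge 0 n with hn | hn
  · obtain ⟨k, rfl⟩ : ∃ k : ℕ, n = k + 1 := ⟨(n - 1).toNat, by omega⟩
    rw [if_pos (by omega), if_pos (by omega), show ((k : ℤ) + 1).toNat = k + 1 by omega,
      show ((k : ℤ) + 1 - 1).toNat = k by omega, Finset.prod_range_succ', mul_comm]
    simp only [hshift]
    push_cast
    rfl
  · obtain ⟨k, rfl⟩ : ∃ k : ℕ, n = -k := ⟨(-n).toNat, by omega⟩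
    have hprod : ∏ j ∈ Finset.range (k + 1), w ((f ^ (-(k : ℤ) - 1 + j)) (f x)) =
        (∏ j ∈ Finset.range k, w ((f ^ (-(k : ℤ) + j)) x)) * w x := by
      simp only [hshift, Finset.prod_range_succ]
      congr 1
      · refine Finset.prod_congr rfl fun j _ => ?_
        rw [show -(k : ℤ) - 1 + j + 1 = -k + j by ring]
      · rw [show -(k : ℤ) - 1 + k + 1 = 0 by ring]
        rfl
    rw [if_neg (show ¬(0 : ℤ) ≤ -(k : ℤ) - 1 by omega),
      show (-(-(k : ℤ) - 1)).toNat = k + 1 by omega, hprod, mul_inv, mul_comm (_⁻¹),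
      mul_inv_cancel_left₀ (hw x)]
    rcases k.eq_zero_or_pos with rfl | hk
    · simp
    · rw [if_neg (by omega), show (- -(k : ℤ)).toNat = k by omega]

section Weight

variable {𝕜 X : Type*} [RCLike 𝕜] [MeasurableSpace X] {μ : Measure X} {p : ℝ≥0∞}

theorem eLpNorm_mul_eq_eLpNorm_withDensity (hp0 : p ≠ 0) (hp : p ≠ ⊤) {h : X → 𝕜}
    (hh : Measurable h) (ψ : X → 𝕜) :
    eLpNorm (fun x => h x * ψ x) p μ =
      eLpNorm ψ p (μ.withDensity fun x => ‖h x‖ₑ ^ p.toReal) := by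
  have hq : 0 < p.toReal := ENNReal.toReal_pos hp0 hp
  rw [eLpNorm_eq_lintegral_rpow_enorm_toReal hp0 hp, eLpNorm_eq_lintegral_rpow_enorm_toReal hp0 hp,
    lintegral_withDensity_eq_lintegral_mul_non_measurable _ (hh.enorm.pow_const _)]
  · congr 1
    refine lintegral_congr fun x => ?_
    rw [enorm_mul, ENNReal.mul_rpow_of_nonneg _ _ hq.le]
    rfl
  · exact .of_forall fun x => ENNReal.rpow_lt_top_of_nonneg hq.le enorm_ne_top

theorem absolutelyContinuous_withDensity_rpow_enorm {h : X → 𝕜}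
    (hh : Measurable h) (hne : ∀ x, h x ≠ 0) :
    μ ≪ μ.withDensity fun x => ‖h x‖ₑ ^ p.toReal :=
  withDensity_absolutelyContinuous' (hh.enorm.pow_const _).aemeasurable <| .of_forall fun x =>
    (ENNReal.rpow_pos (enorm_pos.2 (hne x)) enorm_ne_top).ne'

/-- Multiplication by a nowhere vanishing `h` as an isometry from `L^p(|h|^p μ)` onto `L^p(μ)`. -/
theorem exists_linearIsometryEquiv_mul [Fact (1 ≤ p)] (hp : p ≠ ⊤) {h : X → 𝕜}
    (hh : Measurable h) (hne : ∀ x, h x ≠ 0) :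
    ∃ e : Lp 𝕜 p (μ.withDensity fun x => ‖h x‖ₑ ^ p.toReal) ≃ₗᵢ[𝕜] Lp 𝕜 p μ,
      ∀ ψ, ⇑(e ψ) =ᵐ[μ] fun x => h x * ψ x := by
  have hp0 : p ≠ 0 := (zero_lt_one.trans_le (Fact.out : (1 : ℝ≥0∞) ≤ p)).ne'
  set ν := μ.withDensity fun x => ‖h x‖ₑ ^ p.toReal
  have hμν : μ ≪ ν := absolutelyContinuous_withDensity_rpow_enorm hh hne
  have hnorm (ψ : X → 𝕜) : eLpNorm (fun x => h x * ψ x) p μ = eLpNorm ψ p ν :=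
    eLpNorm_mul_eq_eLpNorm_withDensity hp0 hp hh ψ
  have hmem (ψ : Lp 𝕜 p ν) : MemLp (fun x => h x * ψ x) p μ :=
    ⟨(hh.mul (Lp.stronglyMeasurable ψ).measurable).aestronglyMeasurable,
      (hnorm ψ).trans_lt (Lp.eLpNorm_lt_top ψ)⟩
  let L : Lp 𝕜 p ν →ₗᵢ[𝕜] Lp 𝕜 p μ :=
    { toFun := fun ψ => (hmem ψ).toLp _
      map_add' := fun ψ₁ ψ₂ => by
        refine Lp.ext ?_
        filter_upwards [(hmem (ψ₁ + ψ₂)).coeFn_toLp, (hmem ψ₁).coeFn_toLp, (hmem ψ₂).coeFn_toLp,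
          Lp.coeFn_add ((hmem ψ₁).toLp _) ((hmem ψ₂).toLp _), hμν (Lp.coeFn_add ψ₁ ψ₂)]
          with x h1 h2 h3 h4 h5
        have h5 : (ψ₁ + ψ₂ : Lp 𝕜 p ν) x = ψ₁ x + ψ₂ x := h5
        rw [h1, h4, Pi.add_apply, h2, h3, h5, mul_add]
      map_smul' := fun c ψ => by
        refine Lp.ext ?_
        filter_upwards [(hmem (c • ψ)).coeFn_toLp, (hmem ψ).coeFn_toLp,
          Lp.coeFn_smul c ((hmem ψ).toLp _), hμν (Lp.coeFn_smul c ψ)] with x h1 h2 h3 h4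
        have h4 : (c • ψ : Lp 𝕜 p ν) x = c • ψ x := h4
        rw [h1, RingHom.id_apply, h3, Pi.smul_apply, h2, h4, smul_eq_mul, smul_eq_mul,
          mul_left_comm]
      norm_map' := fun ψ => by
        rw [Lp.norm_def]
        change (eLpNorm ((hmem ψ).toLp _) p μ).toReal = _
        rw [eLpNorm_congr_ae (hmem ψ).coeFn_toLp, hnorm, Lp.norm_def] }
  have hL (ψ : Lp 𝕜 p ν) : ⇑(L ψ) =ᵐ[μ] fun x => h x * ψ x := (hmem ψ).coeFn_toLp
  have hsurj : Function.Surjective L := by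
    intro φ
    have hdiv : MemLp (fun x => (h x)⁻¹ * φ x) p ν := by
      refine ⟨(hh.inv.mul (Lp.stronglyMeasurable φ).measurable).aestronglyMeasurable, ?_⟩
      rw [← hnorm]
      simp_rw [mul_inv_cancel_left₀ (hne _)]
      exact Lp.eLpNorm_lt_top φ
    refine ⟨hdiv.toLp _, Lp.ext ?_⟩
    filter_upwards [hL (hdiv.toLp _), hμν hdiv.coeFn_toLp] with x h1 h2
    have h2 : hdiv.toLp _ x = (h x)⁻¹ * φ x := h2
    rw [h1, h2, mul_inv_cancel_left₀ (hne x)]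
  exact ⟨LinearIsometryEquiv.ofSurjective L hsurj, hL⟩

theorem measurable_wpow {f : Equiv.Perm X} {w : X → 𝕜} (hf : ∀ n : ℤ, Measurable ⇑(f ^ n))
    (hw : Measurable w) (n : ℤ) : Measurable (wpow f w n) := by
  unfold wpow
  by_cases hn : 0 ≤ n
  · simp only [if_pos hn]
    exact Finset.measurable_fun_prod _ fun j _ => hw.comp (hf j)
  · simp only [if_neg hn]
    exact (Finset.measurable_fun_prod (Finset.range (-n).toNat)
      fun j _ => hw.comp (hf (n + j))).inv

/-- A wandering set with full saturation yields a level function. -/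
theorem exists_level {f : Equiv.Perm X} (hf : ∀ n : ℤ, Measurable ⇑(f ^ n)) {W : Set X}
    (hW : MeasurableSet W)
    (hWdisj : Pairwise (Function.onFun Disjoint fun n : ℤ => ⇑(f ^ n) '' W))
    (hWcover : (⋃ n : ℤ, ⇑(f ^ n) '' W) = Set.univ) :
    ∃ J : X → ℤ, Measurable J ∧ (∀ x, J (f x) = J x - 1) ∧
      ∀ n : ℤ, ⇑(f ^ n) ⁻¹' W = J ⁻¹' {n} := by
  have hex (x : X) : ∃ n : ℤ, (f ^ n) x ∈ W := by
    obtain ⟨n, hn⟩ := Set.mem_iUnion.1 (hWcover.symm ▸ Set.mem_univ x)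
    rw [zpow_image_eq_preimage] at hn
    exact ⟨-n, hn⟩
  choose J hJ using hex
  have huniq (x : X) (n : ℤ) (hn : (f ^ n) x ∈ W) : J x = n := by
    by_contra hne
    have hdis : Disjoint (⇑(f ^ (-J x)) '' W) (⇑(f ^ (-n)) '' W) :=
      hWdisj fun h => hne (neg_injective h)
    refine Set.disjoint_left.1 hdis (?_ : x ∈ _) ?_
    · rw [zpow_image_eq_preimage, neg_neg]
      exact hJ x
    · rw [zpow_image_eq_preimage, neg_neg]
      exact hn
  have hpre (n : ℤ) : ⇑(f ^ n) ⁻¹' W = J ⁻¹' {n} := by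
    ext x
    refine ⟨huniq x n, ?_⟩
    rintro rfl
    exact hJ x
  refine ⟨J, measurable_to_countable' fun n => hpre n ▸ hf n hW, fun x => huniq _ _ ?_, hpre⟩
  rw [← Equiv.Perm.mul_apply, ← zpow_add_one, sub_add_cancel]
  exact hJ x

theorem nuMeas_eq_withDensity {f : Equiv.Perm X} {w : X → 𝕜} {W : Set X} {J : X → ℤ}
    (hJm : Measurable J) (hJW : ∀ n : ℤ, ⇑(f ^ n) ⁻¹' W = J ⁻¹' {n}) :
    nuMeas μ p f w W = μ.withDensity fun x => ‖wpow f w (J x) x‖ₑ ^ p.toReal := by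
  have hm (n : ℤ) : MeasurableSet (J ⁻¹' {n}) := hJm (measurableSet_singleton n)
  have hunion : ⋃ n : ℤ, J ⁻¹' {n} = Set.univ :=
    Set.eq_univ_of_forall fun x => Set.mem_iUnion.2 ⟨J x, rfl⟩
  have hdisj : Pairwise (Function.onFun Disjoint fun n : ℤ => J ⁻¹' {n}) := fun m n hmn =>
    Disjoint.preimage J (Set.disjoint_singleton.2 hmn)
  rw [← Measure.restrict_univ (μ := μ.withDensity _), ← hunion,
    Measure.restrict_iUnion hdisj hm, nuMeas]
  congr 1
  funext n
  rw [hJW, restrict_withDensity (hm n), restrict_withDensity (hm n)]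
  refine withDensity_congr_ae ?_
  filter_upwards [ae_restrict_mem (hm n)] with x hx
  rw [show J x = n from hx]
  rfl

end Weight

/-- **Theorem.** For a dissipative invertible weighted `p`-measurable system with wandering set
`W` of finite positive measure, `C_{w,f}` is Devaney chaotic on `L^p(μ)` iff for each `ε > 0`
and each `B` with `ν(B) < ∞` there is a measurable `B' ⊆ B` with `ν(B∖B') < ε` and
`Σ_{n ∈ ℤ} ν(fⁿ(B')) < ∞`. -/
theorem dissipative_weighted_composition_devaneyChaotic_iff
    {𝕜 X : Type*} [RCLike 𝕜] [MeasurableSpace X] (μ : Measure X) [SigmaFinite μ]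
    (hμpos : 0 < μ Set.univ)
    (p : ℝ≥0∞) [Fact (1 ≤ p)] (hp : p ≠ ⊤)
    (f : Equiv.Perm X) (hf : Measurable f) (hf' : Measurable f.symm)
    (hns : ∀ B : Set X, MeasurableSet B → (μ (⇑f ⁻¹' B) = 0 ↔ μ B = 0))
    (w : X → 𝕜) (hw_meas : Measurable w) (hw_bdd : ∃ C : ℝ, ∀ x, ‖w x‖ ≤ C)
    (hc : ∃ c : ℝ≥0∞, 0 < c ∧ ∀ B : Set X, MeasurableSet B →
      (∫⁻ x in B, (‖w x‖₊ : ℝ≥0∞) ^ p.toReal ∂μ) ≤ c * μ (⇑f '' B))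
    (hw0 : ∀ x, w x ≠ 0)
    (hwt_bdd : ∃ C : ℝ, ∀ x, ‖(w (f.symm x))⁻¹‖ ≤ C)
    (hc' : ∃ c : ℝ≥0∞, 0 < c ∧ ∀ B : Set X, MeasurableSet B →
      (∫⁻ x in B, (‖(w (f.symm x))⁻¹‖₊ : ℝ≥0∞) ^ p.toReal ∂μ) ≤ c * μ (⇑f ⁻¹' B))
    -- `W` is a wandering set for `f` with `0 < μ(W) < ∞`
    (W : Set X) (hW : MeasurableSet W)
    (hWdisj : Pairwise (Function.onFun Disjoint fun n : ℤ => ⇑(f ^ n) '' W))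
    (hWcover : (⋃ n : ℤ, ⇑(f ^ n) '' W) = Set.univ)
    (hW0 : 0 < μ W) (hW1 : μ W < ⊤)
    -- `T` is the weighted composition operator `C_{w,f}` on `L^p(μ)`
    (T : Lp 𝕜 p μ ≃L[𝕜] Lp 𝕜 p μ)
    (hT : ∀ φ : Lp 𝕜 p μ, ⇑(T φ) =ᵐ[μ] fun x => w x * φ (f x)) :
    DevaneyChaotic (⇑T : Lp 𝕜 p μ → Lp 𝕜 p μ)
    ↔ (∀ ε : ℝ≥0∞, 0 < ε → ∀ B : Set X, MeasurableSet B → nuMeas μ p f w W B < ⊤ →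
        ∃ B' : Set X, MeasurableSet B' ∧ B' ⊆ B ∧ nuMeas μ p f w W (B \ B') < ε ∧
          (∑' n : ℤ, nuMeas μ p f w W (⇑(f ^ n) '' B')) < ⊤) := by
  have hfμ : Measure.QuasiMeasurePreserving f μ μ :=
    ⟨hf, Measure.AbsolutelyContinuous.mk fun B hB h0 => by
      rw [Measure.map_apply hf hB]
      exact (hns B hB).2 h0⟩
  have hfμ' : Measure.QuasiMeasurePreserving f.symm μ μ :=
    ⟨hf', Measure.AbsolutelyContinuous.mk fun B hB h0 => by
      rw [Measure.map_apply hf' hB, ← hns _ (hf' hB), ← Set.preimage_comp]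
      simpa using h0⟩
  have hfn (n : ℤ) := (quasiMeasurePreserving_zpow hfμ hfμ' n).measurable
  obtain ⟨J, hJm, hJ, hJW⟩ := exists_level hfn hW hWdisj hWcover
  set h : X → 𝕜 := fun x => wpow f w (J x) x
  have hh : Measurable h :=
    (measurable_from_prod_countable_left (f := fun z : X × ℤ => wpow f w z.2 z.1)
      fun n => measurable_wpow hfn hw_meas n).comp (measurable_id.prodMk hJm)
  have hne (x : X) : h x ≠ 0 := wpow_ne_zero hw0 _ _
  have hcocycle (x : X) : h x = w x * h (f x) := by
    simp only [h, hJ]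
    exact wpow_eq_mul_wpow_sub_one hw0 _ _
  rw [nuMeas_eq_withDensity hJm hJW]
  set ν := μ.withDensity fun x => ‖h x‖ₑ ^ p.toReal
  obtain ⟨e, he⟩ : ∃ e : Lp 𝕜 p ν ≃ₗᵢ[𝕜] Lp 𝕜 p μ, ∀ ψ, ⇑(e ψ) =ᵐ[μ] fun x => h x * ψ x :=
    exists_linearIsometryEquiv_mul hp hh hne
  have hμν : μ ≪ ν := absolutelyContinuous_withDensity_rpow_enorm hh hne
  have hνμ : ν ≪ μ := withDensity_absolutelyContinuous _ _
  have hfν : Measure.QuasiMeasurePreserving f ν ν := hfμ.mono hνμ hμν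
  have hfν' : Measure.QuasiMeasurePreserving f.symm ν ν := hfμ'.mono hνμ hμν
  set S : Lp 𝕜 p ν ≃L[𝕜] Lp 𝕜 p ν :=
    (e.toContinuousLinearEquiv.trans T).trans e.symm.toContinuousLinearEquiv
  have heS (ψ : Lp 𝕜 p ν) : e (S ψ) = T (e ψ) := e.apply_symm_apply _
  have hS (ψ : Lp 𝕜 p ν) : ⇑(S ψ) =ᵐ[ν] fun x => ψ (f x) := by
    refine hνμ.ae_le ?_
    filter_upwards [he (S ψ), hT (e ψ), hfμ.ae (he ψ)] with x h1 h2 h3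
    rw [heS, h2, h3, ← mul_assoc, ← hcocycle] at h1
    exact (mul_left_cancel₀ (hne x) h1).symm
  rw [← devaneyChaotic_composition_iff hp hfν hfν' hJm hJ S hS]
  exact (devaneyChaotic_iff_of_homeomorph e.toHomeomorph heS).symm
end

section
/- Let (X,𝔐,μ,f,w) be a dissipative invertible weighted p-measurable system with wandering set W satisfying 0 < μ(W) < ∞, and let ν(B) = Σ_{n∈ℤ} μ_n(B ∩ f^{−n}(W)). Then (X,𝔐,μ,f,w) is of bounded distortion on W if and only if the unweighted system (X,𝔐,ν,f) is of bounded distortion on W, i.e. there is a constant K > 0 such that (1/K)·ν(f^k(W))/ν(W) ≤ ν(f^k(B))/ν(B) ≤ K·ν(f^k(W))/ν(W) for all k ∈ ℤ and all measurable B ⊆ W with ν(B) > 0. -/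
open Filter Topology MeasureTheory
open scoped ENNReal NNReal

lemma measurable_zpow_perm {X : Type*} [MeasurableSpace X] {f : Equiv.Perm X}
    (hf : Measurable f) (hf' : Measurable f.symm) (n : ℤ) : Measurable ⇑(f ^ n) := by
  have hpow : ∀ {g : Equiv.Perm X}, Measurable g → ∀ m : ℕ, Measurable ⇑(g ^ m) := by
    intro g hg m
    rw [Equiv.Perm.coe_pow]
    exact hg.iterate m
  obtain ⟨m, rfl | rfl⟩ := n.eq_nat_or_neg
  · rw [zpow_natCast]
    exact hpow hf m
  · rw [zpow_neg, zpow_natCast, ← inv_pow]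
    exact hpow (g := f⁻¹) hf' m

lemma image_zpow_eq_preimage {X : Type*} (f : Equiv.Perm X) (n : ℤ) (B : Set X) :
    ⇑(f ^ n) '' B = ⇑(f ^ (-n)) ⁻¹' B := by
  rw [zpow_neg]
  exact Equiv.image_eq_preimage_symm (f ^ n) B

/-- On the translate `f^k(W)` of a wandering set, `ν` coincides with `μ_{-k}`. -/
lemma nuMeas_image_zpow {𝕜 X : Type*} [RCLike 𝕜] [MeasurableSpace X] (μ : Measure X)
    (p : ℝ≥0∞) {f : Equiv.Perm X} (hf : Measurable f) (hf' : Measurable f.symm) (w : X → 𝕜)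
    {W : Set X} (hWdisj : Pairwise (Function.onFun Disjoint fun n : ℤ => ⇑(f ^ n) '' W))
    (k : ℤ) {B : Set X} (hB : MeasurableSet B) (hBW : B ⊆ W) :
    nuMeas μ p f w W (⇑(f ^ k) '' B) =
      ∫⁻ x in ⇑(f ^ k) '' B, (‖wpow f w (-k) x‖₊ : ℝ≥0∞) ^ p.toReal ∂μ := by
  have hm : MeasurableSet (⇑(f ^ k) '' B) := by
    rw [image_zpow_eq_preimage]
    exact measurable_zpow_perm hf hf' _ hB
  have hsub : ⇑(f ^ k) '' B ⊆ ⇑(f ^ k) '' W := Set.image_mono hBW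
  rw [nuMeas, Measure.sum_apply _ hm, tsum_eq_single (-k)]
  · rw [Measure.restrict_apply hm, ← image_zpow_eq_preimage, Set.inter_eq_left.2 hsub,
      withDensity_apply _ hm]
  · intro n hn
    have hW : ⇑(f ^ n) ⁻¹' W = ⇑(f ^ (-n)) '' W := by rw [image_zpow_eq_preimage, neg_neg]
    have hd : Disjoint (⇑(f ^ k) '' W) (⇑(f ^ (-n)) '' W) :=
      hWdisj (fun h => hn (by rw [h, neg_neg]))
    rw [Measure.restrict_apply hm, hW, (hd.mono_left hsub).inter_eq, measure_empty]

lemma nuMeas_eq_of_subset {𝕜 X : Type*} [RCLike 𝕜] [MeasurableSpace X] (μ : Measure X)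
    (p : ℝ≥0∞) {f : Equiv.Perm X} (hf : Measurable f) (hf' : Measurable f.symm) (w : X → 𝕜)
    {W : Set X} (hWdisj : Pairwise (Function.onFun Disjoint fun n : ℤ => ⇑(f ^ n) '' W))
    {B : Set X} (hB : MeasurableSet B) (hBW : B ⊆ W) :
    nuMeas μ p f w W B = μ B := by
  simpa [wpow] using nuMeas_image_zpow μ p hf hf' w hWdisj 0 hB hBW

/-- **Lemma.** A dissipative invertible weighted `p`-measurable system `(X,𝔐,μ,f,w)` with
wandering set `W` of finite positive measure is of bounded distortion on `W` iff the
unweighted system `(X,𝔐,ν,f)` is of bounded distortion on `W`. -/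
theorem dissipative_boundedDistortion_iff_unweighted
    {𝕜 X : Type*} [RCLike 𝕜] [MeasurableSpace X] (μ : Measure X) [SigmaFinite μ]
    (hμpos : 0 < μ Set.univ)
    (p : ℝ≥0∞) [Fact (1 ≤ p)] (hp : p ≠ ⊤)
    (f : Equiv.Perm X) (hf : Measurable f) (hf' : Measurable f.symm)
    (hns : ∀ B : Set X, MeasurableSet B → (μ (⇑f ⁻¹' B) = 0 ↔ μ B = 0))
    (w : X → 𝕜) (hw_meas : Measurable w) (hw_bdd : ∃ C : ℝ, ∀ x, ‖w x‖ ≤ C)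
    (hc : ∃ c : ℝ≥0∞, 0 < c ∧ ∀ B : Set X, MeasurableSet B →
      (∫⁻ x in B, (‖w x‖₊ : ℝ≥0∞) ^ p.toReal ∂μ) ≤ c * μ (⇑f '' B))
    (hw0 : ∀ x, w x ≠ 0)
    (hwt_bdd : ∃ C : ℝ, ∀ x, ‖(w (f.symm x))⁻¹‖ ≤ C)
    (hc' : ∃ c : ℝ≥0∞, 0 < c ∧ ∀ B : Set X, MeasurableSet B →
      (∫⁻ x in B, (‖(w (f.symm x))⁻¹‖₊ : ℝ≥0∞) ^ p.toReal ∂μ) ≤ c * μ (⇑f ⁻¹' B))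
    -- `W` is a wandering set for `f` with `0 < μ(W) < ∞`
    (W : Set X) (hW : MeasurableSet W)
    (hWdisj : Pairwise (Function.onFun Disjoint fun n : ℤ => ⇑(f ^ n) '' W))
    (hWcover : (⋃ n : ℤ, ⇑(f ^ n) '' W) = Set.univ)
    (hW0 : 0 < μ W) (hW1 : μ W < ⊤)
    :
    (∃ K : ℝ≥0, 0 < K ∧ ∀ k : ℤ, ∀ B : Set X, MeasurableSet B → B ⊆ W → 0 < μ B →
        ((K : ℝ≥0∞))⁻¹ *
            ((∫⁻ x in ⇑(f ^ k) '' W, (‖wpow f w (-k) x‖₊ : ℝ≥0∞) ^ p.toReal ∂μ) / μ W) ≤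
          (∫⁻ x in ⇑(f ^ k) '' B, (‖wpow f w (-k) x‖₊ : ℝ≥0∞) ^ p.toReal ∂μ) / μ B ∧
        (∫⁻ x in ⇑(f ^ k) '' B, (‖wpow f w (-k) x‖₊ : ℝ≥0∞) ^ p.toReal ∂μ) / μ B ≤
          (K : ℝ≥0∞) *
            ((∫⁻ x in ⇑(f ^ k) '' W, (‖wpow f w (-k) x‖₊ : ℝ≥0∞) ^ p.toReal ∂μ) / μ W))
    ↔ (∃ K : ℝ≥0, 0 < K ∧ ∀ k : ℤ, ∀ B : Set X, MeasurableSet B → B ⊆ W →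
        0 < nuMeas μ p f w W B →
        ((K : ℝ≥0∞))⁻¹ *
            (nuMeas μ p f w W (⇑(f ^ k) '' W) / nuMeas μ p f w W W) ≤
          nuMeas μ p f w W (⇑(f ^ k) '' B) / nuMeas μ p f w W B ∧
        nuMeas μ p f w W (⇑(f ^ k) '' B) / nuMeas μ p f w W B ≤
          (K : ℝ≥0∞) *
            (nuMeas μ p f w W (⇑(f ^ k) '' W) / nuMeas μ p f w W W)) := by
  have hν := fun k (B : Set X) => nuMeas_image_zpow μ p hf hf' w hWdisj k (B := B)
  have hν₀ := fun (B : Set X) => nuMeas_eq_of_subset μ p hf hf' w hWdisj (B := B)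
  refine exists_congr fun K => and_congr_right fun _ => forall_congr' fun k =>
    forall_congr' fun B => forall_congr' fun hB => forall_congr' fun hBW => ?_
  rw [hν k B hB hBW, hν k W hW subset_rfl, hν₀ B hB hBW, hν₀ W hW subset_rfl]
end
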